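/- arXiv:2505.02058 — 3 statements merged into one kernel-verified Lean document; each statement's English description precedes it below -/
import Mathlib

section
/- For every integer n ≥ 3, the average number of inversions over all derangements of {1,…,n} satisfies (1/d_n)·∑_{σ ∈ D_n} I(σ) = n(n−1)/4 + n/6 + 1/12 + [((−1)^n/n!)/(∑_{l=0}^n (−1)^l/l!)]·(n−1)/12. -/
/-- Number of inversions of a permutation of `Fin n`: the number of pairs of
positions `a < b` with `σ a > σ b`. -/
def inversions {n : ℕ} (σ : Equiv.Perm (Fin n)) : ℕ :=
  ((Finset.univ : Finset (Fin n × Fin n)).filter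
    (fun p => p.1 < p.2 ∧ σ p.2 < σ p.1)).card

/-- The set of derangements (fixed-point-free permutations) of `Fin n`. -/
def derangeSet (n : ℕ) : Finset (Equiv.Perm (Fin n)) :=
  Finset.univ.filter (fun σ => ∀ x, σ x ≠ x)

/-- The number of derangements of `Fin n` (so `numDerange 0 = 1`). -/
def numDerange (n : ℕ) : ℕ := (derangeSet n).card

/-- The number of fixed points of a permutation of `Fin n`. -/
def fixedPointCount {n : ℕ} (σ : Equiv.Perm (Fin n)) : ℕ :=
  (Finset.univ.filter (fun x => σ x = x)).card

/-- The set of permutations of `Fin n` with exactly `k` fixed points. -/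
def permsWithFixed (n k : ℕ) : Finset (Equiv.Perm (Fin n)) :=
  Finset.univ.filter (fun σ => fixedPointCount σ = k)

/-- The number of permutations of `Fin n` with exactly `k` fixed points. -/
def numPermsWithFixed (n k : ℕ) : ℕ := (permsWithFixed n k).card

open Finset Equiv

section DerangementCounts

variable {n : ℕ}

lemma mem_derangeSet {σ : Perm (Fin n)} : σ ∈ derangeSet n ↔ ∀ x, σ x ≠ x := by
  simp [derangeSet]

lemma numDerange_eq_numDerangements (n : ℕ) : numDerange n = numDerangements n := by
  rw [← card_derangements_fin_eq_numDerangements, numDerange, derangeSet, Fintype.card_subtype]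
  congr 1
  ext σ
  simp only [mem_filter, mem_univ, true_and]
  exact Iff.rfl

lemma conj_mem_derangeSet (τ : Perm (Fin n)) {σ : Perm (Fin n)} (h : σ ∈ derangeSet n) :
    τ * σ * τ⁻¹ ∈ derangeSet n := by
  rw [mem_derangeSet] at h ⊢
  intro x hx
  apply h (τ⁻¹ x)
  apply τ.injective
  simpa using hx

/-- The number of derangements sending `a` to `b`. -/
def numDerangeVia (a b : Fin n) : ℕ := #{σ ∈ derangeSet n | σ a = b}

/-- The number of derangements sending `a` to `b` and `b` to `c`. -/
def numDerangeVia₂ (a b c : Fin n) : ℕ := #{σ ∈ derangeSet n | σ a = b ∧ σ b = c}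

lemma numDerangeVia_le {a b c : Fin n} (hb : b ≠ a) (hc : c ≠ a) :
    numDerangeVia a b ≤ numDerangeVia a c := by
  refine card_le_card_of_injOn (fun σ => swap b c * σ * (swap b c)⁻¹) ?_ ?_
  · intro σ hσ
    simp only [coe_filter, Set.mem_ofPred_eq] at hσ ⊢
    refine ⟨conj_mem_derangeSet _ hσ.1, ?_⟩
    simp [swap_apply_of_ne_of_ne hb.symm hc.symm, hσ.2]
  · intro σ _ τ _ h
    simpa using h

lemma numDerangeVia₂_le {a b c d : Fin n} (hca : c ≠ a) (hcb : c ≠ b)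
    (hda : d ≠ a) (hdb : d ≠ b) : numDerangeVia₂ a b c ≤ numDerangeVia₂ a b d := by
  refine card_le_card_of_injOn (fun σ => swap c d * σ * (swap c d)⁻¹) ?_ ?_
  · intro σ hσ
    simp only [coe_filter, Set.mem_ofPred_eq] at hσ ⊢
    refine ⟨conj_mem_derangeSet _ hσ.1, ?_⟩
    simp [swap_apply_of_ne_of_ne hca.symm hda.symm, swap_apply_of_ne_of_ne hcb.symm hdb.symm,
      hσ.2]
  · intro σ _ τ _ h
    simpa using h

lemma numDerangeVia_self (a : Fin n) : numDerangeVia a a = 0 := by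
  rw [numDerangeVia, card_eq_zero, filter_eq_empty_iff]
  exact fun σ hσ => mem_derangeSet.1 hσ a

lemma numDerangeVia₂_self (a b : Fin n) : numDerangeVia₂ a b b = 0 := by
  rw [numDerangeVia₂, card_eq_zero, filter_eq_empty_iff]
  exact fun σ hσ h => mem_derangeSet.1 hσ b h.2

lemma sub_one_mul_numDerangeVia {a b : Fin n} (hab : a ≠ b) :
    ((n : ℝ) - 1) * numDerangeVia a b = numDerange n := by
  have h : numDerange n = ∑ c, numDerangeVia a c :=
    card_eq_sum_card_fiberwise (f := fun σ : Perm (Fin n) => σ a) (fun _ _ => mem_univ _)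
  rw [h, ← add_sum_erase _ _ (mem_univ a), numDerangeVia_self,
    sum_congr rfl (g := fun _ => numDerangeVia a b) fun c hc =>
      (numDerangeVia_le (ne_of_mem_erase hc) hab.symm).antisymm
        (numDerangeVia_le hab.symm (ne_of_mem_erase hc)),
    sum_const, card_erase_of_mem (mem_univ a), card_univ, Fintype.card_fin]
  have : 1 ≤ n := a.pos
  simp [Nat.cast_sub this]

lemma numDerangeVia₂_swap {a b : Fin n} (hab : a ≠ b) :
    numDerangeVia₂ a b a = numDerangements (n - 2) := by
  have hcard : Fintype.card {x : Fin n // x ≠ a ∧ x ≠ b} = n - 2 := by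
    have : (univ.filter fun x : Fin n => x ≠ a ∧ x ≠ b) = (univ.erase b).erase a := by
      ext; simp
    rw [Fintype.card_subtype, this, card_erase_of_mem (by simp [hab]),
      card_erase_of_mem (mem_univ b), card_univ, Fintype.card_fin]
    omega
  rw [← hcard, ← card_derangements_eq_numDerangements,
    Fintype.card_congr (derangements.subtypeEquiv _), Fintype.card_subtype, numDerangeVia₂]
  have key : ∀ σ : Perm (Fin n), (σ ∈ derangeSet n ∧ σ a = b ∧ σ b = a) ↔
      ∀ x, ¬(x ≠ a ∧ x ≠ b) ↔ x ∈ Function.fixedPoints (σ * swap a b : Perm (Fin n)) := by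
    intro σ
    simp only [mem_derangeSet, Function.mem_fixedPoints, Function.IsFixedPt, Perm.mul_apply]
    constructor
    · rintro ⟨h, h1, h2⟩ x
      by_cases hxa : x = a
      · simp [hxa, h2]
      by_cases hxb : x = b
      · simp [hxb, h1]
      simp [hxa, hxb, swap_apply_of_ne_of_ne hxa hxb, h x]
    · intro h
      have h1 := (h b).1 (by simp)
      have h2 := (h a).1 (by simp)
      simp only [swap_apply_left, swap_apply_right] at h1 h2
      refine ⟨fun x hx => ?_, h1, h2⟩
      by_cases hxa : x = a
      · exact hab (by rw [← hxa, ← hx, hxa, h1])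
      by_cases hxb : x = b
      · exact hab (by rw [← h2, ← hxb, hx])
      exact (h x).2 (by rw [swap_apply_of_ne_of_ne hxa hxb, hx]) ⟨hxa, hxb⟩
  refine card_bij (fun σ _ => σ * swap a b) ?_ ?_ ?_
  · intro σ hσ
    rw [mem_filter] at hσ ⊢
    exact ⟨mem_univ _, (key σ).1 hσ⟩
  · intro σ _ τ _ h
    simpa using h
  · intro τ hτ
    refine ⟨τ * swap a b, ?_, by simp [mul_assoc]⟩
    rw [mem_filter, key]
    simpa [mul_assoc] using hτ

lemma sub_two_mul_numDerangeVia₂ {a b c : Fin n} (hab : a ≠ b) (hca : c ≠ a) (hcb : c ≠ b) :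
    ((n : ℝ) - 2) * numDerangeVia₂ a b c = numDerangeVia a b - numDerangements (n - 2) := by
  have h : numDerangeVia a b = ∑ d, numDerangeVia₂ a b d := by
    simp only [numDerangeVia₂, ← filter_filter]
    exact card_eq_sum_card_fiberwise (f := fun σ : Perm (Fin n) => σ b) (fun _ _ => mem_univ _)
  have hn : 2 ≤ n := by
    have := a.2; have := b.2; have := Fin.val_ne_of_ne hab; omega
  rw [← add_sum_erase _ _ (mem_univ b), numDerangeVia₂_self,
    ← add_sum_erase _ _ (mem_erase.2 ⟨hab, mem_univ a⟩), numDerangeVia₂_swap hab,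
    sum_congr rfl (g := fun _ => numDerangeVia₂ a b c) fun d hd => ?_,
    sum_const, card_erase_of_mem (by simp [hab]), card_erase_of_mem (mem_univ b), card_univ,
    Fintype.card_fin, Nat.sub_sub] at h
  · rw [h]
    simp [Nat.cast_sub hn]
  · have h1 := ne_of_mem_erase hd
    have h2 := ne_of_mem_erase (mem_of_mem_erase hd)
    exact (numDerangeVia₂_le h1 h2 hca hcb).antisymm (numDerangeVia₂_le hca hcb h1 h2)

/-- The sign of `x - y`. -/
def orderSign (x y : Fin n) : ℝ := if y < x then 1 else if x < y then -1 else 0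

lemma orderSign_swap (x y : Fin n) : orderSign y x = -orderSign x y := by
  unfold orderSign
  split_ifs <;> first | omega | simp

lemma orderSign_of_lt {x y : Fin n} (h : x < y) : orderSign y x = 1 := if_pos h

lemma orderSign_self (x : Fin n) : orderSign x x = 0 := by simp [orderSign]

lemma sum_orderSign (x : Fin n) : ∑ y, orderSign x y = 2 * (x : ℝ) - (n - 1) := by
  have h (y : Fin n) : orderSign x y = (if y < x then 1 else 0) - (if x < y then 1 else 0) := by
    unfold orderSign
    split_ifs <;> first | omega | simp
  have h1 : (univ.filter fun y => y < x) = Iio x := by ext; simp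
  have h2 : (univ.filter fun y => x < y) = Ioi x := by ext; simp
  have := x.2
  simp only [h, sum_sub_distrib, sum_boole, h1, h2, Fin.card_Iio, Fin.card_Ioi]
  rw [Nat.sub_sub, Nat.cast_sub (by omega)]
  push_cast
  ring

lemma sum_orderSign_via {a b : Fin n} (hab : a ≠ b) (hn : 3 ≤ n) :
    ∑ σ ∈ derangeSet n with σ a = b, orderSign b (σ b) =
      numDerangements (n - 2) * orderSign b a +
        (numDerange n / ((n : ℝ) - 1) - numDerangements (n - 2)) / ((n : ℝ) - 2) *
          (2 * (b : ℝ) - (n - 1) - orderSign b a) := by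
  have hn' : (3 : ℝ) ≤ n := by exact_mod_cast hn
  have h : ∑ σ ∈ derangeSet n with σ a = b, orderSign b (σ b) =
      ∑ c, numDerangeVia₂ a b c * orderSign b c := by
    rw [← sum_fiberwise _ (fun σ : Perm (Fin n) => σ b)]
    refine sum_congr rfl fun c _ => ?_
    rw [sum_congr rfl (g := fun _ => orderSign b c), sum_const, filter_filter, nsmul_eq_mul,
      numDerangeVia₂]
    intro σ hσ
    rw [(mem_filter.1 hσ).2]
  have hvia : (numDerangeVia a b : ℝ) = numDerange n / ((n : ℝ) - 1) := by
    rw [eq_div_iff (by linarith), mul_comm, sub_one_mul_numDerangeVia hab]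
  have ha : a ∈ univ.erase b := mem_erase.2 ⟨hab, mem_univ a⟩
  rw [h, ← sum_orderSign, ← add_sum_erase _ _ (mem_univ b), ← add_sum_erase _ _ ha,
    ← add_sum_erase _ (orderSign b) (mem_univ b), ← add_sum_erase _ _ ha, orderSign_self,
    numDerangeVia₂_swap hab, mul_zero, zero_add, zero_add, add_sub_cancel_left, mul_sum]
  congr 1
  refine sum_congr rfl fun c hc => ?_
  congr 1
  rw [eq_div_iff (by linarith), mul_comm, ← hvia]
  exact sub_two_mul_numDerangeVia₂ hab (ne_of_mem_erase hc)
    (ne_of_mem_erase (mem_of_mem_erase hc))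

/-- Right multiplication by `swap a b` cancels all derangements except those sending `a` to `b`
or `b` to `a`. -/
lemma sum_orderSign_avoiding {a b : Fin n} (hab : a ≠ b) :
    ∑ σ ∈ derangeSet n with ¬(σ a = b ∨ σ b = a), orderSign (σ a) (σ b) = 0 := by
  refine sum_involution (fun σ _ => σ * swap a b) ?_ ?_ ?_ ?_
  · intro σ _
    simp [orderSign_swap (σ a) (σ b)]
  · intro σ _ _ h
    exact hab (by simpa [swap_eq_one_iff] using h)
  · intro σ hσ
    simp only [mem_filter, mem_derangeSet, not_or, Perm.mul_apply, swap_apply_left,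
      swap_apply_right] at hσ ⊢
    refine ⟨fun x => ?_, hσ.1 b, hσ.1 a⟩
    by_cases hxa : x = a
    · simpa [hxa] using hσ.2.2
    by_cases hxb : x = b
    · simpa [hxb] using hσ.2.1
    rw [swap_apply_of_ne_of_ne hxa hxb]
    exact hσ.1 x
  · intro σ _
    simp [mul_assoc]

lemma sum_orderSign_derangeSet {a b : Fin n} (hab : a < b) (hn : 3 ≤ n) :
    ∑ σ ∈ derangeSet n, orderSign (σ a) (σ b) =
      numDerangements (n - 2) +
        (numDerange n / ((n : ℝ) - 1) - numDerangements (n - 2)) / ((n : ℝ) - 2) *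
          (2 * ((b : ℝ) - a) - 2) := by
  have h1 : ∑ σ ∈ derangeSet n with σ a = b, orderSign (σ a) (σ b) =
      ∑ σ ∈ derangeSet n with σ a = b, orderSign b (σ b) :=
    sum_congr rfl fun σ hσ => by rw [(mem_filter.1 hσ).2]
  have h2 : ∑ σ ∈ derangeSet n with σ b = a, orderSign (σ a) (σ b) =
      -∑ σ ∈ derangeSet n with σ b = a, orderSign a (σ a) := by
    rw [← sum_neg_distrib]
    exact sum_congr rfl fun σ hσ => by rw [(mem_filter.1 hσ).2, orderSign_swap a]
  have h3 : ∑ σ ∈ derangeSet n with σ a = b ∧ σ b = a, orderSign (σ a) (σ b) =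
      numDerangements (n - 2) := by
    rw [← numDerangeVia₂_swap hab.ne, numDerangeVia₂, sum_congr rfl (g := fun _ => 1)]
    · simp
    · intro σ hσ
      obtain ⟨_, ha, hb⟩ := mem_filter.1 hσ
      rw [ha, hb, orderSign_of_lt hab]
  have h4 := sum_union_inter (s₁ := {σ ∈ derangeSet n | σ a = b})
    (s₂ := {σ ∈ derangeSet n | σ b = a}) (f := fun σ => orderSign (σ a) (σ b))
  rw [← filter_or, ← filter_and, h1, h2, h3, sum_orderSign_via hab.ne hn,
    sum_orderSign_via hab.ne' hn, orderSign_swap b a, orderSign_of_lt hab] at h4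
  rw [← sum_filter_add_sum_filter_not _ (fun σ : Perm (Fin n) => σ a = b ∨ σ b = a),
    sum_orderSign_avoiding hab.ne]
  linear_combination h4

lemma inversions_eq_sum_orderSign (σ : Perm (Fin n)) :
    (inversions σ : ℝ) =
      ∑ p : Fin n × Fin n with p.1 < p.2, (1 + orderSign (σ p.1) (σ p.2)) / 2 := by
  rw [inversions, ← filter_filter, card_filter, Nat.cast_sum]
  refine sum_congr rfl fun p hp => ?_
  have hne : σ p.1 ≠ σ p.2 := σ.injective.ne (mem_filter.1 hp).2.ne
  rcases hne.lt_or_gt with h | h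
  · simp [orderSign, h, h.not_gt]
  · simp [orderSign, h]

end DerangementCounts

lemma sum_filter_fst_lt_snd (n : ℕ) (c d : ℝ) :
    ∑ p : Fin n × Fin n with p.1 < p.2, (c + d * ((p.2 : ℝ) - p.1)) =
      c * (n * (n - 1) / 2) + d * ((n + 1) * n * (n - 1) / 6) := by
  have inner (b : ℕ) : ∑ a ∈ range b, (c + d * ((b : ℝ) - a)) = c * b + d * (b * (b + 1) / 2) := by
    have h (m : ℕ) : ∑ a ∈ range m, (c + d * ((b : ℝ) - a)) =
        c * m + d * (b * m - m * (m - 1) / 2) := by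
      induction m with
      | zero => simp
      | succ m ih => rw [sum_range_succ, ih]; push_cast; ring
    rw [h]; ring
  have outer : ∑ b ∈ range n, (c * (b : ℝ) + d * (b * (b + 1) / 2)) =
      c * (n * (n - 1) / 2) + d * ((n + 1) * n * (n - 1) / 6) := by
    induction n with
    | zero => simp
    | succ m ih => rw [sum_range_succ, ih]; push_cast; ring
  rw [← outer, sum_filter, Fintype.sum_prod_type_right, ← Fin.sum_univ_eq_sum_range
    (fun b => c * (b : ℝ) + d * (b * (b + 1) / 2))]
  refine sum_congr rfl fun b _ => ?_
  rw [← inner b, ← sum_filter]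
  refine sum_bij (fun a _ => (a : ℕ)) ?_ ?_ ?_ ?_
  · intro a ha
    simpa using ha
  · intro a _ a' _ h
    exact Fin.ext h
  · intro a ha
    exact ⟨⟨a, (mem_range.1 ha).trans b.2⟩, mem_filter.2 ⟨mem_univ _, mem_range.1 ha⟩, rfl⟩
  · intro a _
    rfl

lemma numDerangements_eq_factorial_mul (n : ℕ) :
    (numDerangements n : ℝ) =
      n.factorial * ∑ l ∈ range (n + 1), (-1 : ℝ) ^ l / l.factorial := by
  have hs (m : ℕ) : (numDerangements (m + 1) : ℝ) =
      (m + 1) * numDerangements m - (-1) ^ m := by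
    exact_mod_cast numDerangements_succ m
  induction n with
  | zero => simp
  | succ m ih =>
    have h1 : (m.factorial : ℝ) ≠ 0 := by positivity
    rw [hs, ih, sum_range_succ _ (m + 1), Nat.factorial_succ]
    push_cast
    field_simp
    ring

lemma numDerangements_add_two_pos (n : ℕ) : 0 < numDerangements (n + 2) := by
  induction n with
  | zero => decide
  | succ m ih =>
    rw [numDerangements_add_two (m + 1)]
    exact Nat.mul_pos (by omega) (Nat.add_pos_right _ ih)

/-- The expected number of inversions of a uniformly random derangement of `{1,…,n}`. -/
theorem stmt0 (n : ℕ) (hn : 3 ≤ n) :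
    ((numDerange n : ℝ))⁻¹ * ∑ σ ∈ derangeSet n, (inversions σ : ℝ) =
      (n : ℝ) * ((n : ℝ) - 1) / 4 + (n : ℝ) / 6 + 1 / 12 +
        ((-1 : ℝ) ^ n / (Nat.factorial n : ℝ)) /
            (∑ l ∈ Finset.range (n + 1), (-1 : ℝ) ^ l / (Nat.factorial l : ℝ)) *
          (((n : ℝ) - 1) / 12) := by
  obtain ⟨m, rfl⟩ : ∃ m, n = m + 2 := ⟨n - 2, by omega⟩
  have hm : 1 ≤ m := by omega
  have hm' : (m : ℝ) ≠ 0 := by positivity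
  have hpos : (numDerangements (m + 2) : ℝ) ≠ 0 := by
    exact_mod_cast (numDerangements_add_two_pos m).ne'
  have hsum : ∑ σ ∈ derangeSet (m + 2), (inversions σ : ℝ) =
      numDerange (m + 2) * ((m + 2 : ℝ) * (m + 1) / 4) +
        (m + 2) * numDerange (m + 2) / 6 + (m + 2) * (m + 1) * numDerangements m / 12 := by
    simp only [inversions_eq_sum_orderSign]
    rw [sum_comm]
    set A : ℝ := (numDerangements m : ℝ) with hA
    set D : ℝ := (numDerange (m + 2) : ℝ) with hD
    have : ∀ p ∈ ({p | p.1 < p.2} : Finset (Fin (m + 2) × Fin (m + 2))),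
        ∑ σ ∈ derangeSet (m + 2), (1 + orderSign (σ p.1) (σ p.2)) / 2 =
          (D + A) / 2 - (D / (m + 1) - A) / m + (D / (m + 1) - A) / m * ((p.2 : ℝ) - p.1) := by
      intro p hp
      rw [← sum_div, sum_add_distrib, sum_orderSign_derangeSet (mem_filter.1 hp).2 hn, sum_const,
        nsmul_one, ← numDerange, ← hD, Nat.add_sub_cancel, ← hA]
      push_cast
      rw [show (m : ℝ) + 2 - 1 = m + 1 by ring, show (m : ℝ) + 2 - 2 = m by ring]
      ring
    rw [sum_congr rfl this, sum_filter_fst_lt_snd]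
    have : (m : ℝ) + 1 ≠ 0 := by positivity
    push_cast
    field_simp
    ring
  have hrec : ((m : ℝ) + 2) * (m + 1) * numDerangements m =
      numDerangements (m + 2) + (m + 1) * (-1) ^ m := by
    have h1 : (numDerangements (m + 1) : ℝ) = (m + 1) * numDerangements m - (-1) ^ m := by
      exact_mod_cast numDerangements_succ m
    have h2 : (numDerangements (m + 2) : ℝ) =
        ((m + 1 : ℕ) + 1) * numDerangements (m + 1) - (-1) ^ (m + 1) := by
      exact_mod_cast numDerangements_succ (m + 1)
    rw [h2, h1]
    push_cast
    ring
  rw [div_div, ← numDerangements_eq_factorial_mul, hsum, numDerange_eq_numDerangements, hrec]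
  push_cast
  field_simp
  ring
end

section
/- For every integer n ≥ 3 and every integer k with 1 ≤ k ≤ n and k ≠ n−1, the average number of inversions over all permutations of {1,…,n} with exactly k fixed points satisfies (1/d_{n,k})·∑_{σ ∈ D_{n,k}} I(σ) = n(n−1)/4 − (k−1)·n/6 − (k²−k−1)/12 + [((−1)^{n−k}/(n−k)!)/(∑_{l=0}^{n−k} (−1)^l/l!)]·(n−k−1)/12. -/
open Finset Equiv

/-- The number of permutations of `Fin n` with `k` fixed points that map `a` to `c` and
`b` to `d`. -/
def numMapPair (n k : ℕ) (a b c d : Fin n) : ℕ :=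
  #{σ ∈ permsWithFixed n k | σ a = c ∧ σ b = d}

variable {n : ℕ}

lemma mem_permsWithFixed {k : ℕ} {σ : Perm (Fin n)} :
    σ ∈ permsWithFixed n k ↔ fixedPointCount σ = k := by
  simp [permsWithFixed]

lemma fixedPointCount_conj (π σ : Perm (Fin n)) :
    fixedPointCount (π * σ * π⁻¹) = fixedPointCount σ := by
  refine (card_equiv π fun x => ?_).symm
  rw [mem_filter, mem_filter]
  simp

lemma numMapPair_perm (k : ℕ) (π : Perm (Fin n)) (a b c d : Fin n) :
    numMapPair n k (π a) (π b) (π c) (π d) = numMapPair n k a b c d := by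
  unfold numMapPair
  refine card_bij' (fun σ _ => π⁻¹ * σ * π) (fun σ _ => π * σ * π⁻¹) ?_ ?_ ?_ ?_
  · intro σ hσ
    simp only [mem_filter, mem_permsWithFixed, Perm.mul_apply] at hσ ⊢
    have := fixedPointCount_conj π⁻¹ σ
    rw [inv_inv] at this
    simp [this, hσ]
  · intro σ hσ
    simp only [mem_filter, mem_permsWithFixed] at hσ ⊢
    simp [fixedPointCount_conj, hσ]
  · intro σ _; group
  · intro σ _; group

lemma numMapPair_comm (k : ℕ) (a b c d : Fin n) :
    numMapPair n k a b c d = numMapPair n k b a d c := by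
  simp only [numMapPair, and_comm]

/-- A function on tuples that is invariant under relabelling is constant on injective tuples. -/
lemma exists_const_of_perm_invariant {α β : Type*} [Finite α] [Nonempty β] {m : ℕ}
    (f : (Fin m → α) → β) (hf : ∀ (π : Perm α) x, f (fun i => π (x i)) = f x) :
    ∃ c, ∀ x : Fin m → α, x.Injective → f x = c := by
  by_cases h : ∃ x : Fin m → α, x.Injective
  · obtain ⟨x, hx⟩ := h
    refine ⟨f x, fun y hy => ?_⟩
    obtain ⟨π, hπ⟩ := Perm.exists_extending_pair x y hx hy
    rw [← hf π x, funext hπ]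
  · push Not at h
    exact ⟨Classical.arbitrary β, fun x hx => absurd hx (h x)⟩

lemma injective_vecCons {α : Type*} {m : ℕ} {a : α} {v : Fin m → α} (ha : ∀ i, v i ≠ a)
    (hv : v.Injective) : (Matrix.vecCons a v).Injective :=
  Fin.cons_injective_iff.2 ⟨fun ⟨i, hi⟩ => ha i hi, hv⟩

lemma injective_vec2 {α : Type*} {a b : α} (hab : b ≠ a) : Function.Injective ![a, b] :=
  injective_vecCons (by simpa using hab) (Function.injective_of_subsingleton _)

lemma injective_vec3 {α : Type*} {a b c : α} (hab : b ≠ a) (hac : c ≠ a) (hbc : c ≠ b) :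
    Function.Injective ![a, b, c] :=
  injective_vecCons (by simp [Fin.forall_fin_succ, hab, hac]) (injective_vec2 hbc)

lemma injective_vec4 {α : Type*} {a b c d : α} (hab : b ≠ a) (hac : c ≠ a) (had : d ≠ a)
    (hbc : c ≠ b) (hbd : d ≠ b) (hcd : d ≠ c) : Function.Injective ![a, b, c, d] :=
  injective_vecCons (by simp [Fin.forall_fin_succ, hab, hac, had]) (injective_vec3 hbc hbd hcd)

/-- `numMapPair` depends only on the coincidences between sources and targets. -/
lemma exists_numMapPair_eq (n k : ℕ) : ∃ E F G T Q : ℝ,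
    (∀ a b : Fin n, a ≠ b → numMapPair n k a b a b = E) ∧
    (∀ a b : Fin n, a ≠ b → numMapPair n k a b b a = T) ∧
    ∀ a b c d : Fin n, a ≠ b → (numMapPair n k a b c d : ℝ) =
      Q + (F - Q) * ((if c = a then 1 else 0) + (if d = b then 1 else 0)) +
      (G - Q) * ((if c = b then 1 else 0) + (if d = a then 1 else 0)) +
      (E - 2 * F + Q) * ((if c = a then 1 else 0) * (if d = b then 1 else 0)) +
      (T - 2 * G + Q) * ((if c = b then 1 else 0) * (if d = a then 1 else 0)) -
      (if d = c then 1 else 0) *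
        (Q + (F + G - 2 * Q) * ((if c = a then 1 else 0) + (if c = b then 1 else 0))) := by
  obtain ⟨E, hE⟩ := exists_const_of_perm_invariant (m := 2)
    (fun x : Fin 2 → Fin n => (numMapPair n k (x 0) (x 1) (x 0) (x 1) : ℝ))
    (fun π x => by simp only [numMapPair_perm])
  obtain ⟨T, hT⟩ := exists_const_of_perm_invariant (m := 2)
    (fun x : Fin 2 → Fin n => (numMapPair n k (x 0) (x 1) (x 1) (x 0) : ℝ))
    (fun π x => by simp only [numMapPair_perm])
  obtain ⟨F, hF⟩ := exists_const_of_perm_invariant (m := 3)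
    (fun x : Fin 3 → Fin n => (numMapPair n k (x 0) (x 1) (x 0) (x 2) : ℝ))
    (fun π x => by simp only [numMapPair_perm])
  obtain ⟨G, hG⟩ := exists_const_of_perm_invariant (m := 3)
    (fun x : Fin 3 → Fin n => (numMapPair n k (x 0) (x 1) (x 1) (x 2) : ℝ))
    (fun π x => by simp only [numMapPair_perm])
  obtain ⟨Q, hQ⟩ := exists_const_of_perm_invariant (m := 4)
    (fun x : Fin 4 → Fin n => (numMapPair n k (x 0) (x 1) (x 2) (x 3) : ℝ))
    (fun π x => by simp only [numMapPair_perm])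
  replace hE (a b : Fin n) (h : a ≠ b) : (numMapPair n k a b a b : ℝ) = E := hE ![a, b] (injective_vec2 h.symm)
  replace hT (a b : Fin n) (h : a ≠ b) : (numMapPair n k a b b a : ℝ) = T := hT ![a, b] (injective_vec2 h.symm)
  replace hF (a b c : Fin n) (h : a ≠ b) (h' : c ≠ a) (h'' : c ≠ b) :
      (numMapPair n k a b a c : ℝ) = F := hF ![a, b, c] (injective_vec3 h.symm h' h'')
  replace hG (a b c : Fin n) (h : a ≠ b) (h' : c ≠ a) (h'' : c ≠ b) :
      (numMapPair n k a b b c : ℝ) = G := hG ![a, b, c] (injective_vec3 h.symm h' h'')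
  refine ⟨E, F, G, T, Q, hE, hT, fun a b c d hab => ?_⟩
  by_cases hcd : c = d
  · subst hcd
    have h0 : numMapPair n k a b c c = 0 := by
      simp only [numMapPair, card_eq_zero, filter_eq_empty_iff]
      rintro σ - ⟨ha, hb⟩
      exact hab (σ.injective (ha.trans hb.symm))
    by_cases hca : c = a
    · subst hca
      simp only [h0, hab, if_true, if_false]; push_cast; ring
    · simp only [h0, hca, if_true, if_false]; push_cast; ring
  by_cases hca : c = a
  · subst hca
    by_cases hdb : d = b
    · subst hdb
      simp only [hE _ _ hab, hab, hab.symm, if_true, if_false]; ring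
    · simp only [hF _ _ _ hab (Ne.symm hcd) hdb, hab, Ne.symm hcd, hdb, if_true, if_false]; ring
  by_cases hcb : c = b
  · subst hcb
    by_cases hda : d = a
    · subst hda
      simp only [hT _ _ hab, hab, hab.symm, if_true, if_false]; ring
    · simp only [hG _ _ _ hab hda (Ne.symm hcd), hab.symm, hda, Ne.symm hcd, if_true, if_false]; ring
  by_cases hda : d = a
  · subst hda
    rw [numMapPair_comm, hG _ _ _ hab.symm hcb hca]
    simp only [hca, hcb, Ne.symm hcd, hab, if_true, if_false]; ring
  by_cases hdb : d = b
  · subst hdb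
    rw [numMapPair_comm, hF _ _ _ hab.symm hcb hca]
    simp only [hca, hcb, Ne.symm hcb, hab.symm, if_true, if_false]; ring
  have : (numMapPair n k a b c d : ℝ) = Q := hQ ![a, b, c, d]
    (injective_vec4 hab.symm hca hda hcb hdb (Ne.symm hcd))
  simp [this, hca, hcb, hda, hdb, Ne.symm hcd]

lemma card_filter_fixedPoints_eq (S : Finset (Fin n)) :
    #{σ : Perm (Fin n) | ({x | σ x = x} : Finset (Fin n)) = S} = numDerangements (n - #S) := by
  have h := Fintype.card_congr (derangements.subtypeEquiv fun x : Fin n => x ∉ S)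
  rw [card_derangements_eq_numDerangements] at h
  have hS : Fintype.card {x // x ∉ S} = n - #S := by simp
  rw [← hS, h, Fintype.card_subtype]
  congr 1
  ext σ
  rw [mem_filter, mem_filter]
  simp [Finset.ext_iff, Function.IsFixedPt, iff_comm]

lemma numPermsWithFixed_eq (n k : ℕ) :
    numPermsWithFixed n k = n.choose k * numDerangements (n - k) := by
  have h := card_eq_sum_card_fiberwise (s := permsWithFixed n k)
    (t := powersetCard k (univ : Finset (Fin n)))
    (f := fun σ => ({x | σ x = x} : Finset (Fin n))) (by
      intro σ hσ
      simpa [mem_permsWithFixed, fixedPointCount] using hσ)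
  rw [numPermsWithFixed, h, sum_congr rfl (g := fun _ => numDerangements (n - k))]
  · simp
  · intro S hS
    rw [mem_powersetCard] at hS
    rw [← hS.2, ← card_filter_fixedPoints_eq]
    congr 1
    ext σ
    simp only [mem_filter, mem_permsWithFixed, mem_univ, true_and, fixedPointCount]
    exact ⟨fun h => h.2, fun h => ⟨by rw [h], h⟩⟩

lemma fixedPointCount_swap_mul {a b : Fin n} (hab : a ≠ b) {σ : Perm (Fin n)} (ha : σ a = b)
    (hb : σ b = a) : fixedPointCount (swap a b * σ) = fixedPointCount σ + 2 := by
  have h : ({x | (swap a b * σ) x = x} : Finset (Fin n)) =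
      insert a (insert b ({x | σ x = x} : Finset (Fin n))) := by
    ext x
    rw [mem_filter, mem_insert, mem_insert, mem_filter, Perm.mul_apply]
    by_cases hxa : x = a
    · simp [hxa, ha]
    by_cases hxb : x = b
    · simp [hxb, hb]
    have h1 : σ x ≠ a := fun h => hxb (σ.injective (h.trans hb.symm))
    have h2 : σ x ≠ b := fun h => hxa (σ.injective (h.trans ha.symm))
    simp [hxa, hxb, swap_apply_of_ne_of_ne h1 h2]
  unfold fixedPointCount
  rw [h, card_insert_of_notMem, card_insert_of_notMem]
  · simp [hb, hab]
  · simp [ha, hab, hab.symm]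

lemma numMapPair_swap (k : ℕ) {a b : Fin n} (hab : a ≠ b) :
    numMapPair n k a b b a = numMapPair n (k + 2) a b a b := by
  unfold numMapPair
  refine card_equiv (Equiv.mulLeft (swap a b)) fun σ => ?_
  rw [mem_filter, mem_filter, mem_permsWithFixed, mem_permsWithFixed]
  have ha : (swap a b * σ) a = a ↔ σ a = b := by
    rw [Perm.mul_apply, swap_apply_eq_iff, swap_apply_left]
  have hb : (swap a b * σ) b = b ↔ σ b = a := by
    rw [Perm.mul_apply, swap_apply_eq_iff, swap_apply_right]
  simp only [Equiv.coe_mulLeft, ha, hb]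
  refine and_congr_left fun h => ?_
  rw [fixedPointCount_swap_mul hab h.1 h.2]
  lia

lemma sum_numMapPair_fixed (n k : ℕ) :
    ∑ p ∈ (univ : Finset (Fin n)).offDiag, numMapPair n k p.1 p.2 p.1 p.2 =
      numPermsWithFixed n k * (k * k - k) := by
  unfold numMapPair
  have := sum_card_bipartiteAbove_eq_sum_card_bipartiteBelow
    (s := (univ : Finset (Fin n)).offDiag) (t := permsWithFixed n k)
    (fun p σ => σ p.1 = p.1 ∧ σ p.2 = p.2)
  simp only [bipartiteAbove, bipartiteBelow] at this
  rw [this, sum_congr rfl (g := fun _ => k * k - k)]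
  · simp [numPermsWithFixed]
  · intro σ hσ
    rw [mem_permsWithFixed] at hσ
    rw [← hσ, fixedPointCount, ← offDiag_card]
    congr 1
    ext p
    simp only [mem_filter, mem_offDiag, mem_univ, true_and]
    tauto

lemma sum_card_filter_apply_self (n k : ℕ) :
    ∑ a : Fin n, #{σ ∈ permsWithFixed n k | σ a = a} = numPermsWithFixed n k * k := by
  have := sum_card_bipartiteAbove_eq_sum_card_bipartiteBelow
    (s := (univ : Finset (Fin n))) (t := permsWithFixed n k) (fun a σ => σ a = a)
  simp only [bipartiteAbove, bipartiteBelow] at this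
  rw [this, sum_congr rfl (g := fun _ => k)]
  · simp [numPermsWithFixed]
  · intro σ hσ
    exact mem_permsWithFixed.1 hσ

lemma sum_card_filter_apply_eq (k : ℕ) (a : Fin n) :
    ∑ c : Fin n, #{σ ∈ permsWithFixed n k | σ a = c} = numPermsWithFixed n k :=
  (card_eq_sum_card_fiberwise (fun _ _ => by simp)).symm

lemma sum_numMapPair (k : ℕ) (a b c : Fin n) :
    ∑ d : Fin n, numMapPair n k a b c d = #{σ ∈ permsWithFixed n k | σ a = c} := by
  simp only [numMapPair, ← filter_filter]
  exact (card_eq_sum_card_fiberwise (fun _ _ => by simp)).symm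

lemma sum_inversions (n k : ℕ) :
    ∑ σ ∈ permsWithFixed n k, inversions σ =
      ∑ a : Fin n, ∑ b : Fin n, if a < b then
        ∑ c : Fin n, ∑ d : Fin n, if d < c then numMapPair n k a b c d else 0 else 0 := by
  have h (σ : Perm (Fin n)) : inversions σ = ∑ a : Fin n, ∑ b : Fin n, if a < b then
      ∑ c : Fin n, ∑ d : Fin n, if d < c then if σ a = c ∧ σ b = d then 1 else 0 else 0
      else 0 := by
    rw [inversions, card_filter, ← univ_product_univ, sum_product]
    refine sum_congr rfl fun a _ => sum_congr rfl fun b _ => ?_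
    rw [ite_and]
    congr 1
    rw [sum_eq_single (σ a), sum_eq_single (σ b)]
    · simp
    · intro d _ hd
      simp [hd.symm]
    · simp
    · intro c _ hc
      simp [hc.symm]
    · simp
  simp only [h, numMapPair, card_filter]
  rw [sum_comm]
  refine sum_congr rfl fun a _ => ?_
  rw [sum_comm]
  refine sum_congr rfl fun b _ => ?_
  split_ifs
  · rw [sum_comm]
    refine sum_congr rfl fun c _ => ?_
    rw [sum_comm]
    refine sum_congr rfl fun d _ => ?_
    split_ifs <;> simp
  · simp

lemma sum_range_alternating_div_factorial (m : ℕ) :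
    ∑ l ∈ range (m + 1), (-1 : ℝ) ^ l / (l.factorial : ℝ) =
      numDerangements m / (m.factorial : ℝ) := by
  induction m with
  | zero => simp
  | succ m ih =>
    have h : (numDerangements (m + 1) : ℝ) = (m + 1) * numDerangements m - (-1) ^ m := by
      exact_mod_cast numDerangements_succ m
    rw [sum_range_succ, ih, h, Nat.factorial_succ]
    push_cast
    field_simp
    ring

lemma sum_fin_ite_lt (c : Fin n) : ∑ d : Fin n, (if d < c then (1 : ℝ) else 0) = c := by
  rw [sum_boole, filter_gt_eq_Iio, Fin.card_Iio]

lemma sum_fin_ite_gt (d : Fin n) : ∑ c : Fin n, (if d < c then (1 : ℝ) else 0) = n - 1 - d := by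
  rw [sum_boole, filter_lt_eq_Ioi, Fin.card_Ioi, Nat.sub_sub, Nat.cast_sub (by lia)]
  push_cast
  ring

lemma sum_fin_coe (n : ℕ) : ∑ a : Fin n, (a : ℝ) = n * (n - 1) / 2 := by
  rw [Fin.sum_univ_eq_sum_range (fun i => (i : ℝ))]
  induction n with
  | zero => simp
  | succ n ih => rw [sum_range_succ, ih]; push_cast; ring

lemma sum_fin_coe_sq (n : ℕ) : ∑ a : Fin n, (a : ℝ) ^ 2 = n * (n - 1) * (2 * n - 1) / 6 := by
  rw [Fin.sum_univ_eq_sum_range (fun i => (i : ℝ) ^ 2)]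
  induction n with
  | zero => simp
  | succ n ih => rw [sum_range_succ, ih]; push_cast; ring

lemma sum_fin_ite_lt_affine (n : ℕ) (A B C : ℝ) :
    ∑ a : Fin n, ∑ b : Fin n, (if a < b then A + B * a + C * b else 0) =
      A * (n * (n - 1) / 2) + B * (n * (n - 1) * (n - 2) / 6) +
        C * (n * (n - 1) * (2 * n - 1) / 6) := by
  have h (a b : Fin n) : (if a < b then A + B * a + C * b else 0 : ℝ) =
      A * (if a < b then 1 else 0) + B * (a * (if a < b then 1 else 0)) +
        C * (b * (if a < b then 1 else 0)) := by
    split_ifs <;> ring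
  have h1 : ∑ a : Fin n, ∑ b : Fin n, (if a < b then (1 : ℝ) else 0) = n * (n - 1) / 2 := by
    rw [sum_comm]
    simp only [sum_fin_ite_lt, sum_fin_coe]
  have h2 : ∑ a : Fin n, (a : ℝ) * ∑ b : Fin n, (if a < b then 1 else 0) =
      n * (n - 1) * (n - 2) / 6 := by
    simp only [sum_fin_ite_gt, mul_sub, sum_sub_distrib, ← sum_mul, mul_one, ← pow_two,
      sum_fin_coe, sum_fin_coe_sq]
    ring
  have h3 : ∑ a : Fin n, ∑ b : Fin n, (b : ℝ) * (if a < b then 1 else 0) =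
      n * (n - 1) * (2 * n - 1) / 6 := by
    rw [sum_comm]
    simp only [← mul_sum, sum_fin_ite_lt, ← pow_two, sum_fin_coe_sq]
  simp only [h, sum_add_distrib, ← mul_sum, h1, h2, h3]

lemma sum_inversions_eq (hn : 3 ≤ n) (k : ℕ) :
    ∑ σ ∈ permsWithFixed n k, (inversions σ : ℝ) =
      numPermsWithFixed n k * (n * (n - 1) / 4 - (k - 1) * n / 6 - (k ^ 2 - k : ℝ) / 12) +
        ((k + 2) * (k + 1) * numPermsWithFixed n (k + 2)) / 12 := by
  obtain ⟨E, F, G, T, Q, hE, hT, hW⟩ := exists_numMapPair_eq n k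
  have hoff (m : ℕ) : ∑ p ∈ (univ : Finset (Fin n)).offDiag,
      (numMapPair n m p.1 p.2 p.1 p.2 : ℝ) = numPermsWithFixed n m * (m * m - m) := by
    have := congrArg (Nat.cast (R := ℝ)) (sum_numMapPair_fixed n m)
    push_cast [Nat.cast_sub (Nat.le_mul_self m)] at this
    exact this
  have hcard : ((#(univ : Finset (Fin n)).offDiag : ℕ) : ℝ) = n * n - n := by
    rw [offDiag_card, card_univ, Fintype.card_fin, Nat.cast_sub (Nat.le_mul_self n)]
    push_cast
    rfl
  have e1 : (n * n - n) * E = numPermsWithFixed n k * (k * k - k) := by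
    rw [← hoff, sum_congr rfl (g := fun _ => E) fun p hp => hE _ _ (mem_offDiag.1 hp).2.2]
    rw [sum_const, nsmul_eq_mul, hcard]
  have e2 : (n * n - n) * T = numPermsWithFixed n (k + 2) * ((k + 2) * (k + 1)) := by
    have h := hoff (k + 2)
    rw [sum_congr rfl (g := fun _ => T) fun p hp => by
      have hp := (mem_offDiag.1 hp).2.2
      rw [← numMapPair_swap k hp, hT _ _ hp]] at h
    rw [sum_const, nsmul_eq_mul, hcard] at h
    rw [h]
    push_cast
    ring
  have hV (a b c : Fin n) : (#{σ ∈ permsWithFixed n k | σ a = c} : ℝ) =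
      ∑ d : Fin n, (numMapPair n k a b c d : ℝ) := by
    rw [← sum_numMapPair k a b c, Nat.cast_sum]
  have hV1 (a : Fin n) : (#{σ ∈ permsWithFixed n k | σ a = a} : ℝ) = E + (n - 2) * F := by
    have : Nontrivial (Fin n) := Fin.nontrivial_iff_two_le.2 (by lia)
    obtain ⟨b, hb⟩ := exists_ne a
    rw [hV a b, sum_congr rfl fun d _ => hW a b a d hb.symm]
    simp only [sum_add_distrib, sum_sub_distrib, ← mul_sum, ← sum_mul, sum_ite_eq', sum_const,
      card_univ, Fintype.card_fin, nsmul_eq_mul, mem_univ, if_true, hb.symm, if_false]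
    ring
  have hV2 (a b : Fin n) (h : a ≠ b) :
      (#{σ ∈ permsWithFixed n k | σ a = b} : ℝ) = T + (n - 2) * G := by
    rw [hV a b, sum_congr rfl fun d _ => hW a b b d h]
    simp only [sum_add_distrib, sum_sub_distrib, ← mul_sum, ← sum_mul, sum_ite_eq', sum_const,
      card_univ, Fintype.card_fin, nsmul_eq_mul, mem_univ, if_true, h.symm, if_false]
    ring
  have e3 : n * (E + (n - 2) * F) = numPermsWithFixed n k * k := by
    have h := congrArg (Nat.cast (R := ℝ)) (sum_card_filter_apply_self n k)
    push_cast at h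
    rw [← h, sum_congr rfl fun a _ => hV1 a]
    simp [mul_add]
  have hd (a : Fin n) : ∑ c : Fin n, (#{σ ∈ permsWithFixed n k | σ a = c} : ℝ) =
      numPermsWithFixed n k := by
    rw [← sum_card_filter_apply_eq k a, Nat.cast_sum]
  let a : Fin n := ⟨0, by lia⟩
  let b : Fin n := ⟨1, by lia⟩
  have hab : a ≠ b := by simp [a, b]
  have e4 : (E + (n - 2) * F) + (n - 1) * (T + (n - 2) * G) = numPermsWithFixed n k := by
    rw [← hd a, ← add_sum_erase _ _ (mem_univ a), hV1,
      sum_congr rfl fun c hc => hV2 a c (ne_of_mem_erase hc).symm]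
    simp [mul_add, Nat.cast_sub (show 1 ≤ n by lia)]
  have e5 : n * n * Q + 2 * n * (F - Q) + 2 * n * (G - Q) + (E - 2 * F + Q) + (T - 2 * G + Q) -
      (n * Q + 2 * (F + G - 2 * Q)) = numPermsWithFixed n k := by
    rw [← hd a, sum_congr rfl fun c _ => hV a b c,
      sum_congr rfl fun c _ => sum_congr rfl fun d _ => hW a b c d hab]
    simp only [sum_add_distrib, sum_sub_distrib, ← mul_sum, ← sum_mul, sum_ite_eq', sum_const,
      card_univ, Fintype.card_fin, nsmul_eq_mul, mem_univ, if_true]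
    ring
  have hI (a b : Fin n) (h : a < b) :
      ∑ c : Fin n, ∑ d : Fin n, (if d < c then (numMapPair n k a b c d : ℝ) else 0) =
        (Q * (n * (n - 1) / 2) + (F - Q + (G - Q)) * (n - 1) + (T - 2 * G + Q)) +
          ((F - Q) - (G - Q)) * a + ((G - Q) - (F - Q)) * b := by
    have h' (c d : Fin n) : (if d < c then (numMapPair n k a b c d : ℝ) else 0) =
        Q * (if d < c then 1 else 0) +
        (F - Q) * ((if c = a then if d < c then 1 else 0 else 0) +
          (if d = b then if d < c then 1 else 0 else 0)) +
        (G - Q) * ((if c = b then if d < c then 1 else 0 else 0) +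
          (if d = a then if d < c then 1 else 0 else 0)) +
        (E - 2 * F + Q) * (if c = a then if d = b then if d < c then 1 else 0 else 0 else 0) +
        (T - 2 * G + Q) * (if c = b then if d = a then if d < c then 1 else 0 else 0 else 0) := by
      rw [hW a b c d h.ne]
      by_cases hdc : d < c
      · simp only [hdc, hdc.ne, if_true, if_false, ← ite_and, ite_zero_mul_ite_zero, mul_one]
        ring
      · simp [hdc]
    have hc (x : Fin n) : ∑ c : Fin n, ∑ d : Fin n,
        (if c = x then if d < c then (1 : ℝ) else 0 else 0) = x := by
      rw [sum_comm]
      simp only [sum_ite_eq', mem_univ, if_true, sum_fin_ite_lt]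
    have hd (x : Fin n) : ∑ c : Fin n, ∑ d : Fin n,
        (if d = x then if d < c then (1 : ℝ) else 0 else 0) = n - 1 - x := by
      simp only [sum_ite_eq', mem_univ, if_true, sum_fin_ite_gt]
    have hcd (x y : Fin n) : ∑ c : Fin n, ∑ d : Fin n,
        (if c = x then if d = y then if d < c then (1 : ℝ) else 0 else 0 else 0) =
          if y < x then 1 else 0 := by
      rw [sum_comm]
      simp only [sum_ite_eq', mem_univ, if_true]
    simp only [h', sum_add_distrib, ← mul_sum, hc, hd, hcd, h, h.not_gt, if_true, if_false,
      sum_fin_ite_lt, sum_fin_coe]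
    ring
  have hS : ∑ σ ∈ permsWithFixed n k, (inversions σ : ℝ) =
      ∑ a : Fin n, ∑ b : Fin n, if a < b then
        (Q * (n * (n - 1) / 2) + (F - Q + (G - Q)) * (n - 1) + (T - 2 * G + Q)) +
          ((F - Q) - (G - Q)) * a + ((G - Q) - (F - Q)) * b else 0 := by
    have h := congrArg (Nat.cast (R := ℝ)) (sum_inversions n k)
    push_cast at h
    rw [h]
    refine sum_congr rfl fun a _ => sum_congr rfl fun b _ => ?_
    split_ifs with hab
    · exact hI a b hab
    · rfl
  rw [hS, sum_fin_ite_lt_affine]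
  linear_combination n * (n - 1) / 4 * e5 - (n - 1) / 6 * e3 - e1 / 12 + n / 6 * e4 - 1 / 6 * e3 +
    e2 / 12

lemma numDerangements_ne_zero {m : ℕ} (hm : m ≠ 1) : (numDerangements m : ℝ) ≠ 0 := by
  have h (m : ℕ) : numDerangements (m + 2) ≠ 0 := by
    induction m with
    | zero => decide
    | succ m ih => rw [numDerangements_add_two]; positivity
  match m with
  | 0 => simp
  | 1 => exact absurd rfl hm
  | m + 2 => exact_mod_cast h m

lemma add_two_mul_add_one_mul_numPermsWithFixed (k m : ℕ) :
    ((k + 2) * (k + 1) * numPermsWithFixed (k + m) (k + 2) : ℝ) =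
      (k + m).choose k * (numDerangements m + (m - 1) * (-1) ^ m) := by
  match m with
  | 0 => simp [numPermsWithFixed_eq, Nat.choose_eq_zero_of_lt]
  | 1 => simp [numPermsWithFixed_eq]
  | m + 2 =>
    have h1 := Nat.choose_succ_right_eq (k + (m + 2)) k
    have h2 := Nat.choose_succ_right_eq (k + (m + 2)) (k + 1)
    rw [show k + (m + 2) - k = m + 2 by lia] at h1
    rw [show k + (m + 2) - (k + 1) = m + 1 by lia] at h2
    replace h1 := congrArg (Nat.cast (R := ℝ)) h1
    replace h2 := congrArg (Nat.cast (R := ℝ)) h2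
    have h3 : (numDerangements (m + 1) : ℝ) = (m + 1) * numDerangements m - (-1) ^ m := by
      exact_mod_cast numDerangements_succ m
    rw [numPermsWithFixed_eq, show k + (m + 2) - (k + 2) = m by lia, numDerangements_add_two]
    push_cast [h3, pow_succ] at h1 h2 ⊢
    linear_combination (k + 1) * numDerangements m * h2 + (m + 1) * numDerangements m * h1

/-- The expected number of inversions of a uniformly random permutation of `{1,…,n}`
with exactly `k` fixed points. -/
theorem stmt2 (n k : ℕ) (hn : 3 ≤ n) (hk1 : 1 ≤ k) (hk2 : k ≤ n) (hk3 : k ≠ n - 1) :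
    ((numPermsWithFixed n k : ℝ))⁻¹ * ∑ σ ∈ permsWithFixed n k, (inversions σ : ℝ) =
      (n : ℝ) * ((n : ℝ) - 1) / 4 - ((k : ℝ) - 1) * (n : ℝ) / 6 -
        ((k : ℝ) ^ 2 - (k : ℝ) - 1) / 12 +
        ((-1 : ℝ) ^ (n - k) / (Nat.factorial (n - k) : ℝ)) /
            (∑ l ∈ Finset.range (n - k + 1), (-1 : ℝ) ^ l / (Nat.factorial l : ℝ)) *
          (((n : ℝ) - (k : ℝ) - 1) / 12) := by
  obtain ⟨m, rfl⟩ := Nat.exists_eq_add_of_le hk2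
  have hm : m ≠ 1 := by lia
  rw [sum_inversions_eq hn, sum_range_alternating_div_factorial, Nat.add_sub_cancel_left,
    div_div_div_cancel_right₀ (by positivity)]
  have hD : (numDerangements m : ℝ) ≠ 0 := numDerangements_ne_zero hm
  have hd : (numPermsWithFixed (k + m) k : ℝ) = (k + m).choose k * numDerangements m := by
    rw [numPermsWithFixed_eq, Nat.add_sub_cancel_left, Nat.cast_mul]
  have hc : ((k + m).choose k : ℝ) ≠ 0 := by
    exact_mod_cast (Nat.choose_pos (Nat.le_add_right k m)).ne'
  rw [add_two_mul_add_one_mul_numPermsWithFixed, hd]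
  push_cast
  field_simp
  ring
end

section
/- Let (k_n) be a sequence of integers with 0 ≤ k_n ≤ n, k_n ≠ n−1 for all n, and lim_{n→∞} k_n/n = 0. Then lim_{n→∞} (1/(n²·d_{n,k_n}))·∑_{σ ∈ D_{n,k_n}} I(σ) = 1/4. -/
section

open Finset Equiv

theorem mem_permsWithFixed_conj {n k : ℕ} (τ σ : Perm (Fin n)) :
    τ * σ * τ⁻¹ ∈ permsWithFixed n k ↔ σ ∈ permsWithFixed n k := by
  have h : fixedPointCount (τ * σ * τ⁻¹) = fixedPointCount σ := by
    unfold fixedPointCount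
    exact (card_equiv τ fun x => by rw [mem_filter, mem_filter]; simp).symm
  simp [permsWithFixed, h]

theorem sum_inversions_conj {n k : ℕ} (τ : Perm (Fin n)) :
    ∑ σ ∈ permsWithFixed n k, inversions (τ * σ * τ⁻¹) =
      ∑ σ ∈ permsWithFixed n k, inversions σ := by
  refine sum_equiv (MulAut.conj τ).toEquiv (fun σ => ?_) (fun σ _ => ?_)
  · simp [mem_permsWithFixed_conj]
  · simp

theorem numPermsWithFixed_pos {n k : ℕ} (h : k + 2 ≤ n) : 0 < numPermsWithFixed n k := by
  obtain ⟨g, hg⟩ := (Perm.exists_with_cycleType_iff (Fin n) (m := {n - k})).2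
    ⟨by simp, by simp; omega⟩
  unfold numPermsWithFixed permsWithFixed fixedPointCount
  refine card_pos.2 ⟨g, ?_⟩
  have h₁ : #g.support = n - k := by rw [← Perm.sum_cycleType, hg]; simp
  have h₂ := card_filter_add_card_filter_not (s := (univ : Finset (Fin n))) (fun x => g x = x)
  have h₃ : univ.filter (fun x => ¬ g x = x) = g.support := by ext; simp
  rw [h₃, h₁, card_univ, Fintype.card_fin] at h₂
  simp only [mem_filter, mem_univ, true_and]
  omega

/-- Composing with a transposition of `u` and `v` exchanges their images. -/
theorem two_mul_card_filter_lt {α : Type*} [Fintype α] [DecidableEq α] [LinearOrder α]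
    (p : Perm α → Prop) [DecidablePred p] {u v : α} (huv : u ≠ v)
    (hp : ∀ τ, p (τ * swap u v) ↔ p τ) :
    2 * #{τ : Perm α | p τ ∧ τ v < τ u} = #{τ : Perm α | p τ} := by
  have h₁ : #{τ : Perm α | p τ ∧ τ v < τ u} = #{τ : Perm α | p τ ∧ ¬ τ v < τ u} := by
    refine card_equiv (Equiv.mulRight (swap u v)) fun τ => ?_
    have : τ v ≠ τ u := fun h => huv (τ.injective h).symm
    simp only [mem_filter, mem_univ, true_and, coe_mulRight, hp, Perm.mul_apply,
      swap_apply_left, swap_apply_right, not_lt]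
    exact and_congr_right fun _ => ⟨le_of_lt, fun h => lt_of_le_of_ne h this⟩
  have h₂ := card_filter_add_card_filter_not (s := ({τ : Perm α | p τ} : Finset _))
    (fun τ => τ v < τ u)
  simp only [filter_filter] at h₂
  omega

theorem four_mul_card_filter_lt_lt {n : ℕ} {x y u v : Fin n} (hxy : x ≠ y) (huv : u ≠ v)
    (hxu : x ≠ u) (hxv : x ≠ v) (hyu : y ≠ u) (hyv : y ≠ v) :
    4 * #{τ : Perm (Fin n) | τ x < τ y ∧ τ v < τ u} = n.factorial := by
  have h₁ := two_mul_card_filter_lt (fun τ : Perm (Fin n) => τ x < τ y) huv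
    (fun τ => by simp [swap_apply_of_ne_of_ne, *])
  have h₂ := two_mul_card_filter_lt (fun _ : Perm (Fin n) => True) hxy.symm (fun _ => Iff.rfl)
  simp only [true_and, filter_true, card_univ, Fintype.card_perm, Fintype.card_fin] at h₂
  omega

theorem sum_inversions_conj_eq {n : ℕ} (σ : Perm (Fin n)) :
    ∑ τ : Perm (Fin n), inversions (τ * σ * τ⁻¹) =
      ∑ p : Fin n × Fin n, #{τ : Perm (Fin n) | τ p.1 < τ p.2 ∧ τ (σ p.2) < τ (σ p.1)} := by
  have h (τ : Perm (Fin n)) : inversions (τ * σ * τ⁻¹) =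
      #{p : Fin n × Fin n | τ p.1 < τ p.2 ∧ τ (σ p.2) < τ (σ p.1)} := by
    unfold inversions
    exact (card_equiv (τ.prodCongr τ) fun p => by rw [mem_filter, mem_filter]; simp).symm
  simp only [h, card_filter]
  exact sum_comm

theorem card_filter_meet_image_le {n : ℕ} (σ : Perm (Fin n)) :
    #{p : Fin n × Fin n | p.1 = p.2 ∨ σ p.1 = p.1 ∨ σ p.2 = p.2 ∨ σ p.1 = p.2 ∨ σ p.2 = p.1} ≤
      (3 + 2 * fixedPointCount σ) * n := by
  set F : Finset (Fin n) := {x | σ x = x} with hF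
  have hsub : ({p : Fin n × Fin n | p.1 = p.2 ∨ σ p.1 = p.1 ∨ σ p.2 = p.2 ∨ σ p.1 = p.2 ∨
      σ p.2 = p.1} : Finset _) ⊆ univ.image (fun x => (x, x)) ∪ (F ×ˢ univ ∪ (univ ×ˢ F ∪
        (univ.image (fun x => (x, σ x)) ∪ univ.image (fun x => (σ x, x))))) := by
    rintro ⟨x, y⟩
    simp only [mem_filter, mem_univ, true_and, mem_union, mem_image, mem_product, hF,
      Prod.mk.injEq, and_true, exists_eq_left, exists_eq_right]
    tauto
  have himage (f : Fin n → Fin n × Fin n) : #(univ.image f) ≤ n := by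
    simpa using card_image_le (s := univ) (f := f)
  refine (card_le_card hsub).trans ?_
  refine (card_union_le _ _).trans <| (add_le_add (himage _) <| (card_union_le _ _).trans <|
    add_le_add_right ((card_union_le _ _).trans <| add_le_add_right ((card_union_le _ _).trans <|
      add_le_add (himage _) (himage _)) _) _).trans ?_
  have : #F = fixedPointCount σ := rfl
  simp only [card_product, card_univ, Fintype.card_fin, this]
  apply le_of_eq
  ring

theorem abs_four_mul_sum_inversions_conj_sub_le {n : ℕ} (σ : Perm (Fin n)) :
    |4 * ∑ τ : Perm (Fin n), (inversions (τ * σ * τ⁻¹) : ℝ) - n.factorial * n ^ 2| ≤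
      4 * (n.factorial : ℝ) * ((3 + 2 * fixedPointCount σ) * n) := by
  set N : Fin n × Fin n → ℕ := fun p =>
    #{τ : Perm (Fin n) | τ p.1 < τ p.2 ∧ τ (σ p.2) < τ (σ p.1)} with hN
  set q : Fin n × Fin n → Prop := fun p =>
    p.1 = p.2 ∨ σ p.1 = p.1 ∨ σ p.2 = p.2 ∨ σ p.1 = p.2 ∨ σ p.2 = p.1 with hq
  have hN_le (p) : (N p : ℝ) ≤ n.factorial := by
    have := card_le_univ ({τ : Perm (Fin n) | τ p.1 < τ p.2 ∧ τ (σ p.2) < τ (σ p.1)} : Finset _)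
    rw [Fintype.card_perm, Fintype.card_fin] at this
    exact_mod_cast this
  have hterm (p) : |4 * (N p : ℝ) - n.factorial| ≤ if q p then 4 * (n.factorial : ℝ) else 0 := by
    split_ifs with h
    · have := hN_le p
      have : (0 : ℝ) ≤ N p := Nat.cast_nonneg _
      rw [abs_le]
      constructor <;> linarith
    · simp only [hq, not_or] at h
      obtain ⟨h₁, h₂, h₃, h₄, h₅⟩ := h
      have := four_mul_card_filter_lt_lt h₁ (σ.injective.ne h₁) (Ne.symm h₂) (Ne.symm h₅)
        (Ne.symm h₄) (Ne.symm h₃)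
      have : 4 * (N p : ℝ) = n.factorial := by exact_mod_cast this
      simp [this]
  have hsum : 4 * ∑ τ : Perm (Fin n), (inversions (τ * σ * τ⁻¹) : ℝ) - n.factorial * n ^ 2 =
      ∑ p, (4 * (N p : ℝ) - n.factorial) := by
    rw [← Nat.cast_sum, sum_inversions_conj_eq, sum_sub_distrib, ← mul_sum, Nat.cast_sum]
    simp [hN]
    ring
  rw [hsum]
  refine (abs_sum_le_sum_abs _ _).trans ((sum_le_sum fun p _ => hterm p).trans ?_)
  rw [← sum_filter, sum_const, nsmul_eq_mul, mul_comm]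
  have := card_filter_meet_image_le σ
  gcongr
  exact_mod_cast this

theorem abs_four_mul_sum_inversions_sub_le (n k : ℕ) :
    |4 * ∑ σ ∈ permsWithFixed n k, (inversions σ : ℝ) - n ^ 2 * numPermsWithFixed n k| ≤
      4 * ((3 + 2 * k) * n : ℝ) * numPermsWithFixed n k := by
  have hpos : (0 : ℝ) < n.factorial := by exact_mod_cast n.factorial_pos
  have hsum : (n.factorial : ℝ) * ∑ σ ∈ permsWithFixed n k, (inversions σ : ℝ) =
      ∑ σ ∈ permsWithFixed n k, ∑ τ : Perm (Fin n), (inversions (τ * σ * τ⁻¹) : ℝ) := by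
    rw [sum_comm]
    simp_rw [← Nat.cast_sum, sum_inversions_conj]
    simp [Fintype.card_perm]
  have heq : n.factorial * (4 * ∑ σ ∈ permsWithFixed n k, (inversions σ : ℝ) -
      n ^ 2 * numPermsWithFixed n k) = ∑ σ ∈ permsWithFixed n k,
        (4 * ∑ τ : Perm (Fin n), (inversions (τ * σ * τ⁻¹) : ℝ) - n.factorial * n ^ 2) := by
    rw [sum_sub_distrib, ← mul_sum, ← hsum, sum_const, nsmul_eq_mul, numPermsWithFixed]
    ring
  refine le_of_mul_le_mul_left ?_ hpos
  rw [← abs_of_pos hpos, ← abs_mul, abs_of_pos hpos, heq]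
  refine (abs_sum_le_sum_abs _ _).trans ((sum_le_sum fun σ hσ =>
    (abs_four_mul_sum_inversions_conj_sub_le σ).trans_eq ?_).trans_eq
      (sum_const (4 * (n.factorial : ℝ) * ((3 + 2 * k) * n))) |>.trans_eq ?_)
  · rw [(mem_filter.1 hσ).2]
  · rw [nsmul_eq_mul, numPermsWithFixed]
    ring

end

/-- If `k n / n → 0`, then the expected number of inversions of a uniformly random
permutation with `k n` fixed points, divided by `n²`, tends to `1/4`. -/
theorem stmt5 (k : ℕ → ℕ) (hk : ∀ n, k n ≤ n) (hk' : ∀ n, k n + 1 ≠ n)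
    (hlim : Filter.Tendsto (fun n => (k n : ℝ) / (n : ℝ)) Filter.atTop (nhds 0)) :
    Filter.Tendsto
      (fun n : ℕ => (1 / ((n : ℝ) ^ 2 * (numPermsWithFixed n (k n) : ℝ))) *
        ∑ σ ∈ permsWithFixed n (k n), (inversions σ : ℝ))
      Filter.atTop (nhds (1 / 4)) := by
  have hbound : Filter.Tendsto (fun n : ℕ => 3 * (1 / (n : ℝ)) + 2 * ((k n : ℝ) / n))
      Filter.atTop (nhds 0) := by
    simpa using (tendsto_one_div_atTop_nhds_zero_nat.const_mul (3 : ℝ)).add (hlim.const_mul 2)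
  rw [tendsto_iff_norm_sub_tendsto_zero]
  refine squeeze_zero' (.of_forall fun _ => norm_nonneg _) ?_ hbound
  filter_upwards [hlim.eventually_lt_const one_pos, Filter.eventually_gt_atTop 0] with n hn hn₀
  have hn₀' : (0 : ℝ) < n := by exact_mod_cast hn₀
  rw [div_lt_one hn₀', Nat.cast_lt] at hn
  have hd : (0 : ℝ) < numPermsWithFixed n (k n) := by
    have := hk' n
    exact_mod_cast numPermsWithFixed_pos (by omega)
  have h := abs_four_mul_sum_inversions_sub_le n (k n)
  rw [Real.norm_eq_abs]
  set S := ∑ σ ∈ permsWithFixed n (k n), (inversions σ : ℝ)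
  set d := (numPermsWithFixed n (k n) : ℝ)
  have hden : 0 < 4 * ((n : ℝ) ^ 2 * d) := by positivity
  have h₁ : 1 / ((n : ℝ) ^ 2 * d) * S - 1 / 4 = (4 * S - n ^ 2 * d) / (4 * (n ^ 2 * d)) := by
    field_simp
  rw [h₁, abs_div, abs_of_pos hden, div_le_iff₀ hden]
  refine h.trans_eq ?_
  field_simp
end
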